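/- arXiv:1607.05285 — 3 statements merged into one kernel-verified Lean document; each statement's English description precedes it below -/
import Mathlib

section
/- Let V be a real symmetric positive definite quantum covariance matrix on three subsystems A, B, C, i.e., V + i·Ω is positive semidefinite as a complex matrix, where Ω = Ω_{n_A} ⊕ Ω_{n_B} ⊕ Ω_{n_C}. Then log det V_{AC} + log det V_{BC} ≥ log det V_A + log det V_B, where the subscripts denote principal submatrices. -/
open Matrix
open scoped ComplexOrder Kronecker

noncomputable section

/-- The standard symplectic form on a single mode. -/
def J2 : Matrix (Fin 2) (Fin 2) ℝ := !![0, 1; -1, 0]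

/-- The standard symplectic form on `n` modes: the direct sum of `n` copies of
`[[0,1],[-1,0]]`, realized on the index type `Fin n × Fin 2`. -/
def Omega (n : ℕ) : Matrix (Fin n × Fin 2) (Fin n × Fin 2) ℝ :=
  (1 : Matrix (Fin n) (Fin n) ℝ) ⊗ₖ J2

/-- `V` is a quantum covariance matrix with respect to the symplectic form `Om`:
the complex matrix `V + i·Om` is positive semidefinite. -/
def QCM {ι : Type*} [Fintype ι] (Om V : Matrix ι ι ℝ) : Prop :=
  (V.map Complex.ofReal + Complex.I • Om.map Complex.ofReal).PosSemidef

/-- The positive semidefinite square root of a positive semidefinite real matrix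
(junk value `0` if the matrix is not positive semidefinite). -/
def msqrt {ι : Type*} [Fintype ι] [DecidableEq ι] (A : Matrix ι ι ℝ) : Matrix ι ι ℝ := by
  classical exact if h : A.PosSemidef then
    h.1.eigenvectorUnitary.1 * diagonal ((RCLike.ofReal : ℝ → ℝ) ∘ Real.sqrt ∘ h.1.eigenvalues) *
      (star h.1.eigenvectorUnitary : Matrix ι ι ℝ)
  else 0

/-- `g₋(A) = Σ_i max(−log ν_i, 0)` where `ν_1, …, ν_n` are the symplectic eigenvalues of `A`
(w.r.t. the symplectic form `Om`), i.e. the eigenvalues of the Hermitian matrix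
`i·√A·Om·√A` are exactly `±ν_1, …, ±ν_n`; equivalently, half the sum of
`max(−log |λ|, 0)` over all eigenvalues `λ` of `i·√A·Om·√A`. -/
def gMinus {ι : Type*} [Fintype ι] [DecidableEq ι] (Om A : Matrix ι ι ℝ) : ℝ := by
  classical exact
    if h : (Complex.I • ((msqrt A * Om * msqrt A).map Complex.ofReal)).IsHermitian then
      (∑ j, max (-Real.log |h.eigenvalues j|) 0) / 2
    else 0

/-- `g₊(A) = Σ_i max(log ν_i, 0)` where `ν_1, …, ν_n` are the symplectic eigenvalues of `A`
(w.r.t. the symplectic form `Om`). -/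
def gPlus {ι : Type*} [Fintype ι] [DecidableEq ι] (Om A : Matrix ι ι ℝ) : ℝ := by
  classical exact
    if h : (Complex.I • ((msqrt A * Om * msqrt A).map Complex.ofReal)).IsHermitian then
      (∑ j, max (Real.log |h.eigenvalues j|) 0) / 2
    else 0

/-- Schur complement of the first (upper-left) diagonal block of a block matrix:
`M/M₁₁ = M₂₂ − M₂₁ M₁₁⁻¹ M₁₂`. -/
def schurA {a b : Type*} [Fintype a] [DecidableEq a]
    (M : Matrix (a ⊕ b) (a ⊕ b) ℝ) : Matrix b b ℝ :=
  M.toBlocks₂₂ - M.toBlocks₂₁ * M.toBlocks₁₁⁻¹ * M.toBlocks₁₂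

/-- Schur complement of the second (lower-right) diagonal block of a block matrix:
`M/M₂₂ = M₁₁ − M₁₂ M₂₂⁻¹ M₂₁`. -/
def schurB {a b : Type*} [Fintype b] [DecidableEq b]
    (M : Matrix (a ⊕ b) (a ⊕ b) ℝ) : Matrix a a ℝ :=
  M.toBlocks₁₁ - M.toBlocks₁₂ * M.toBlocks₂₂⁻¹ * M.toBlocks₂₁

/-- Embedding of the `A ⊕ C` indices into `A ⊕ (B ⊕ C)`. -/
def embAC {a b c : Type*} : a ⊕ c → a ⊕ (b ⊕ c) :=
  Sum.elim Sum.inl (Sum.inr ∘ Sum.inr)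

/-- Embedding of the `A ⊕ B` indices into `A ⊕ (B ⊕ C)`. -/
def embAB {a b c : Type*} : a ⊕ b → a ⊕ (b ⊕ c) :=
  Sum.elim Sum.inl (Sum.inr ∘ Sum.inl)



lemma one_le_det_one_add {c : Type*} [Fintype c] [DecidableEq c] {S : Matrix c c ℝ}
    (hS : S.PosSemidef) : 1 ≤ (1 + S).det := by
  have h := hS.1.spectral_theorem
  rw [Unitary.conjStarAlgAut_apply] at h
  set U : Matrix c c ℝ := (hS.1.eigenvectorUnitary : Matrix c c ℝ) with hU
  have hUU : U * star U = 1 := Unitary.coe_mul_star_self hS.1.eigenvectorUnitary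
  have e : 1 + S = U * (diagonal (fun i => 1 + hS.1.eigenvalues i)) * star U := by
    have : (diagonal (fun i => 1 + hS.1.eigenvalues i) : Matrix c c ℝ)
        = 1 + diagonal (RCLike.ofReal ∘ hS.1.eigenvalues) := by
      rw [← diagonal_one, diagonal_add]; rfl
    rw [this, mul_add, add_mul, mul_one, hUU, ← h]
  have hd : U.det * (star U).det = 1 := by rw [← det_mul, hUU, det_one]
  rw [e, det_mul, det_mul, mul_right_comm, hd, one_mul, det_diagonal]
  calc (1 : ℝ) = ∏ _i : c, (1 : ℝ) := by simp
    _ ≤ _ := Finset.prod_le_prod (fun _ _ => zero_le_one)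
      (fun i _ => by linarith [hS.eigenvalues_nonneg i])

lemma one_le_det_mul_det {c : Type*} [Fintype c] [DecidableEq c] {P Q R : Matrix c c ℝ}
    (hR : R.PosDef) (hQ : Q.det * Q.det = 1) (h : (fromBlocks P Q Qᴴ R).PosSemidef) :
    1 ≤ P.det * R.det := by
  have : Invertible R := hR.isUnit.invertible
  have hS := (PosDef.fromBlocks₂₂ P Q hR).1 h
  obtain ⟨B, hB⟩ : ∃ B : Matrix c c ℝ, R⁻¹ = Bᴴ * B := by
    have := hR.inv.posSemidef
    open scoped MatrixOrder in
    exact CStarAlgebra.nonneg_iff_eq_star_mul_self.1 this.nonneg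
  have hRd := hR.det_pos
  have hBd : B.det * B.det * R.det = 1 := by
    have : (Bᴴ * B).det * R.det = 1 := by
      rw [← hB, ← det_mul, nonsing_inv_mul _ hRd.ne'.isUnit, det_one]
    simpa [det_mul] using this
  set W := Q * Bᴴ with hW
  have hWd : W.det * W.det * R.det = 1 := by
    rw [hW, det_mul, det_conjTranspose]; simp only [star_trivial]
    calc _ = (Q.det * Q.det) * (B.det * B.det * R.det) := by ring
      _ = 1 := by rw [hQ, hBd, one_mul]
  have hWu : IsUnit W.det := by
    rw [isUnit_iff_ne_zero]; intro h0; simp [h0] at hWd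
  set S := P - Q * R⁻¹ * Qᴴ with hSdef
  have hS' := hS.mul_mul_conjTranspose_same W⁻¹
  have hP : P = W * (1 + W⁻¹ * S * W⁻¹ᴴ) * Wᴴ := by
    have h1 : W * Wᴴ = Q * R⁻¹ * Qᴴ := by
      rw [hW, hB, conjTranspose_mul, conjTranspose_conjTranspose]; simp only [Matrix.mul_assoc]
    have h2 : W⁻¹ᴴ * Wᴴ = 1 := by
      rw [← conjTranspose_mul, mul_nonsing_inv _ hWu, conjTranspose_one]
    have h3 : W * (W⁻¹ * S * W⁻¹ᴴ) * Wᴴ = S := by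
      calc _ = (W * W⁻¹) * S * (W⁻¹ᴴ * Wᴴ) := by simp only [Matrix.mul_assoc]
        _ = S := by rw [mul_nonsing_inv _ hWu, h2, one_mul, mul_one]
    rw [mul_add, add_mul, mul_one, h1, h3, hSdef]; abel
  have h1 := one_le_det_one_add hS'
  rw [hP, det_mul, det_mul, det_conjTranspose, star_trivial]
  calc 1 ≤ (1 + W⁻¹ * S * W⁻¹ᴴ).det := h1
    _ = (1 + W⁻¹ * S * W⁻¹ᴴ).det * (W.det * W.det * R.det) := by rw [hWd, mul_one]
    _ = _ := by ring

lemma qcm_real {ι : Type*} [Fintype ι] {Om V : Matrix ι ι ℝ}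
    (h : QCM Om V) (x y : ι → ℝ) :
    0 ≤ x ⬝ᵥ V *ᵥ x + y ⬝ᵥ V *ᵥ y + x ⬝ᵥ Om *ᵥ y - y ⬝ᵥ Om *ᵥ x := by
  have := h.re_dotProduct_nonneg (fun i => (x i : ℂ) - Complex.I * (y i : ℂ))
  refine this.trans_eq ?_
  simp only [dotProduct, mulVec, Finset.mul_sum, RCLike.re_to_complex, Complex.re_sum,
    ← Finset.sum_add_distrib, ← Finset.sum_sub_distrib]
  refine Finset.sum_congr rfl fun i _ => Finset.sum_congr rfl fun j _ => ?_
  simp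
  ring

lemma block_psd {ι c : Type*} [Fintype ι] [Fintype c] {Om V : Matrix ι ι ℝ}
    (h : QCM Om V) (hV : Vᵀ = V) (hO : Omᵀ = -Om) (X Y : Matrix ι c ℝ) :
    (fromBlocks (Xᵀ * V * X) (Xᵀ * Om * Y) (Xᵀ * Om * Y)ᴴ (Yᵀ * V * Y)).PosSemidef := by
  refine .of_dotProduct_mulVec_nonneg ?_ fun z => ?_
  · rw [isHermitian_fromBlocks_iff]
    refine ⟨?_, rfl, conjTranspose_conjTranspose _, ?_⟩ <;>
    simp [IsHermitian, conjTranspose_eq_transpose_of_trivial, Matrix.transpose_mul, hV,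
      Matrix.mul_assoc]
  · have := qcm_real h (X *ᵥ (z ∘ Sum.inl)) (Y *ᵥ (z ∘ Sum.inr))
    refine this.trans_eq ?_
    have hz : z = Sum.elim (z ∘ Sum.inl) (z ∘ Sum.inr) := by simp
    generalize z ∘ Sum.inl = u at *
    generalize z ∘ Sum.inr = w at *
    subst hz
    rw [star_trivial, fromBlocks_mulVec, Sum.elim_comp_inl, Sum.elim_comp_inr]
    rw [sumElim_dotProduct_sumElim]
    have key : ∀ (M : Matrix ι ι ℝ) (X Y : Matrix ι c ℝ) (u w : c → ℝ),
        (X *ᵥ u) ⬝ᵥ M *ᵥ (Y *ᵥ w) = u ⬝ᵥ (Xᵀ * M * Y) *ᵥ w := by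
      intro M X Y u w
      rw [← mulVec_mulVec, ← mulVec_mulVec, dotProduct_mulVec u, vecMul_transpose]
    have h2 : (Xᵀ * Om * Y)ᴴ = - (Yᵀ * Om * X) := by
      simp [conjTranspose_eq_transpose_of_trivial, Matrix.transpose_mul, hO, Matrix.mul_assoc]
    simp only [key, h2, dotProduct_add, neg_mulVec, dotProduct_neg]
    ring

lemma fromRows_add_aux {a b c : Type*} (A A' : Matrix a c ℝ) (B B' : Matrix b c ℝ) :
    fromRows A B + fromRows A' B' = fromRows (A + A') (B + B') := by
  ext (i | i) j <;> rfl

lemma Omega_transpose (n : ℕ) : (Omega n)ᵀ = -Omega n := by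
  ext ⟨i, a⟩ ⟨j, b⟩
  fin_cases a <;> fin_cases b <;> simp [Omega, J2, Matrix.one_apply, eq_comm]

lemma Omega_det (n : ℕ) : (Omega n).det * (Omega n).det = 1 := by
  simp [Omega, det_kronecker, J2, det_fin_two]

lemma det_schur {a c : Type*} [Fintype a] [Fintype c] [DecidableEq a] [DecidableEq c]
    {A : Matrix a a ℝ} (hA : A.PosDef) (B : Matrix a c ℝ) (D : Matrix c c ℝ) :
    (fromBlocks A B Bᵀ D).det = A.det * (D - Bᵀ * A⁻¹ * B).det := by
  have : Invertible A := hA.isUnit.invertible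
  rw [det_fromBlocks₁₁, invOf_eq_nonsing_inv]

/-- **Strong subadditivity of the log-determinant, quantum form.** For a real symmetric
positive definite quantum covariance matrix `V` on `A ⊕ (B ⊕ C)` (i.e. `V + i·Ω ≥ 0`),
`log det V_{AC} + log det V_{BC} ≥ log det V_A + log det V_B`. -/
theorem logdet_quantum_ssa (nA nB nC : ℕ)
    (V : Matrix ((Fin nA × Fin 2) ⊕ ((Fin nB × Fin 2) ⊕ (Fin nC × Fin 2)))
        ((Fin nA × Fin 2) ⊕ ((Fin nB × Fin 2) ⊕ (Fin nC × Fin 2))) ℝ)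
    (hVsymm : V.IsSymm) (hVpd : V.PosDef)
    (hQCM : QCM (fromBlocks (Omega nA) 0 0 (fromBlocks (Omega nB) 0 0 (Omega nC))) V) :
    Real.log (V.submatrix Sum.inl Sum.inl).det
        + Real.log (V.submatrix (Sum.inr ∘ Sum.inl) (Sum.inr ∘ Sum.inl)).det
      ≤ Real.log (V.submatrix (embAC (b := Fin nB × Fin 2))
            (embAC (b := Fin nB × Fin 2))).det
        + Real.log (V.submatrix Sum.inr Sum.inr).det := by
  set A := V.submatrix Sum.inl Sum.inl with hA
  set B := V.submatrix (Sum.inr ∘ Sum.inl) (Sum.inr ∘ Sum.inl) with hB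
  set C := V.submatrix (Sum.inr ∘ Sum.inr) (Sum.inr ∘ Sum.inr) with hC
  set E := V.submatrix Sum.inl (Sum.inr ∘ Sum.inl) with hE
  set F := V.submatrix Sum.inl (Sum.inr ∘ Sum.inr) with hF
  set G := V.submatrix (Sum.inr ∘ Sum.inl) (Sum.inr ∘ Sum.inr) with hG
  have hsym : ∀ i j, V i j = V j i := fun i j => hVsymm.apply j i
  have hAp : A.PosDef := hVpd.submatrix Sum.inl_injective
  have hBp : B.PosDef := hVpd.submatrix (Sum.inr_injective.comp Sum.inl_injective)
  have hAs : Aᵀ = A := by ext i j; exact hsym _ _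
  have hBs : Bᵀ = B := by ext i j; exact hsym _ _
  have hVAC : V.submatrix (embAC (b := Fin nB × Fin 2)) (embAC (b := Fin nB × Fin 2))
      = fromBlocks A F Fᵀ C := by
    ext (i | i) (j | j) <;> first | rfl | exact hsym _ _
  have hVBC : V.submatrix Sum.inr Sum.inr = fromBlocks B G Gᵀ C := by
    ext (i | i) (j | j) <;> first | rfl | exact hsym _ _
  have hV : V = fromBlocks A (fromCols E F) (fromRows Eᵀ Fᵀ) (fromBlocks B G Gᵀ C) := by
    ext (i | i | i) (j | j | j) <;> first | rfl | exact hsym _ _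
  have hACp : (fromBlocks A F Fᵀ C).PosDef := by
    rw [← hVAC]
    refine hVpd.submatrix ?_
    rintro (i | i) (j | j) h <;> simpa [embAC] using h
  have hBCp : (fromBlocks B G Gᵀ C).PosDef := by
    rw [← hVBC]; exact hVpd.submatrix Sum.inr_injective
  have d1 := hACp.det_pos
  have d2 := hBCp.det_pos
  rw [hVAC, hVBC]
  rw [det_schur hAp] at d1 ⊢
  rw [det_schur hBp] at d2 ⊢
  have a0 := hAp.det_pos
  have b0 := hBp.det_pos
  have p0 := pos_of_mul_pos_right d1 a0.le
  have q0 := pos_of_mul_pos_right d2 b0.le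
  have hRp : (C - Gᵀ * B⁻¹ * G).PosDef := by
    have : Invertible B := hBp.isUnit.invertible
    have := (PosDef.fromBlocks₁₁ G C hBp).1
      (by rw [conjTranspose_eq_transpose_of_trivial]; exact hBCp.posSemidef)
    rw [conjTranspose_eq_transpose_of_trivial] at this
    exact this.posDef_iff_isUnit.2 ((isUnit_iff_isUnit_det _).2 q0.ne'.isUnit)
  let X : Matrix ((Fin nA × Fin 2) ⊕ ((Fin nB × Fin 2) ⊕ (Fin nC × Fin 2))) (Fin nC × Fin 2) ℝ :=
    fromRows (-(A⁻¹ * F)) (fromRows 0 1)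
  let Y : Matrix ((Fin nA × Fin 2) ⊕ ((Fin nB × Fin 2) ⊕ (Fin nC × Fin 2))) (Fin nC × Fin 2) ℝ :=
    fromRows 0 (fromRows (-(B⁻¹ * G)) 1)
  have hO : (fromBlocks (Omega nA) 0 0 (fromBlocks (Omega nB) 0 0 (Omega nC)))ᵀ
      = -(fromBlocks (Omega nA) 0 0 (fromBlocks (Omega nB) 0 0 (Omega nC))) := by
    simp [fromBlocks_transpose, Omega_transpose, fromBlocks_neg]
  have hA1 : A * A⁻¹ = 1 := mul_nonsing_inv _ a0.ne'.isUnit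
  have hB1 : B * B⁻¹ = 1 := mul_nonsing_inv _ b0.ne'.isUnit
  have hpsd := block_psd hQCM hVsymm hO X Y
  have e1 : Xᵀ * V * X = C - Fᵀ * A⁻¹ * F := by
    rw [hV]
    have hX : A * -(A⁻¹ * F) + F = 0 := by
      rw [Matrix.mul_neg, ← Matrix.mul_assoc, hA1, Matrix.one_mul, neg_add_cancel]
    rw [Matrix.mul_assoc]
    simp only [X, transpose_fromRows, fromBlocks_mul_fromRows,
      fromCols_mul_fromRows, fromRows_mul, Matrix.mul_zero, zero_add, Matrix.mul_one, hX,
      fromCols_mul_fromRows, transpose_zero, transpose_one, fromRows_add_aux,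
      Matrix.zero_mul, Matrix.one_mul]
    simp only [Matrix.mul_neg, Matrix.mul_assoc, zero_add]
    abel
  have e2 : Yᵀ * V * Y = C - Gᵀ * B⁻¹ * G := by
    rw [hV]
    have hY : B * -(B⁻¹ * G) + G = 0 := by
      rw [Matrix.mul_neg, ← Matrix.mul_assoc, hB1, Matrix.one_mul, neg_add_cancel]
    rw [Matrix.mul_assoc]
    simp only [Y, transpose_fromRows, fromBlocks_mul_fromRows,
      fromCols_mul_fromRows, fromRows_mul, Matrix.mul_zero, zero_add, Matrix.mul_one, hY,
      fromCols_mul_fromRows, transpose_zero, transpose_one,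
      Matrix.zero_mul, Matrix.one_mul]
    simp only [Matrix.mul_neg, Matrix.mul_assoc, zero_add]
    abel
  have e3 : Xᵀ * (fromBlocks (Omega nA) 0 0 (fromBlocks (Omega nB) 0 0 (Omega nC))) * Y
      = Omega nC := by
    rw [Matrix.mul_assoc]
    simp only [X, Y, transpose_fromRows, fromBlocks_mul_fromRows,
      fromCols_mul_fromRows, Matrix.mul_zero, zero_add, add_zero, Matrix.mul_one,
      transpose_zero, transpose_one, Matrix.zero_mul, Matrix.one_mul]
  rw [e1, e2, e3] at hpsd
  have key := one_le_det_mul_det hRp (Omega_det nC) hpsd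
  rw [Real.log_mul a0.ne' p0.ne', Real.log_mul b0.ne' q0.ne']
  have := Real.log_nonneg key
  rw [Real.log_mul p0.ne' q0.ne'] at this
  linarith

end
end

section
/- Determinant decreases under pure Gaussian measurements: let Z be a real symmetric positive definite matrix on two subsystems B ⊕ C such that Z + i·Ω_{BC} is positive semidefinite as a complex matrix (Ω_{BC} = Ω_{n_B} ⊕ Ω_{n_C}), and let γ be a real symmetric positive definite symplectic matrix on C (γ Ω_{n_C} γᵀ = Ω_{n_C}). Then det( (Z + 0_B ⊕ γ) / (Z_C + γ) ) ≤ det Z, where the Schur complement is taken with respect to the C-block and 0_B ⊕ γ denotes γ extended by zeros on B. -/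
open Matrix
open scoped ComplexOrder Kronecker

noncomputable section

theorem aux_one_le_det {ι : Type*} [Fintype ι] [DecidableEq ι] {Q : Matrix ι ι ℝ}
    (hQ : Q.PosSemidef) : 1 ≤ (1 + Q).det := by
  have h1 : (1 + Q).det = ∏ i, (1 + hQ.1.eigenvalues i) := by
    have h := congrArg (Polynomial.eval (-1)) hQ.1.charpoly_eq
    rw [Matrix.eval_charpoly, Polynomial.eval_prod] at h
    have e1 : (scalar ι (-1 : ℝ)) - Q = -(1 + Q) := by
      rw [map_neg, map_one]; abel
    have e2 : ∀ i, Polynomial.eval (-1 : ℝ)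
        (Polynomial.X - Polynomial.C ((hQ.1.eigenvalues i : ℝ))) =
        -(1 + hQ.1.eigenvalues i) := by
      intro i; simp; ring
    rw [e1, det_neg] at h
    simp only [RCLike.ofReal_real_eq_id, id] at h
    rw [Finset.prod_congr rfl (fun i _ => e2 i), Finset.prod_neg] at h
    have h3 : ((-1 : ℝ)) ^ Fintype.card ι ≠ 0 := by positivity
    exact mul_left_cancel₀ h3 h
  rw [h1]
  have h2 : ∏ _i : ι, (1 : ℝ) ≤ ∏ i, (1 + hQ.1.eigenvalues i) :=
    Finset.prod_le_prod (fun _ _ => zero_le_one)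
      (fun i _ => by have := hQ.eigenvalues_nonneg i; linarith)
  simpa using h2

open scoped MatrixOrder Matrix.Norms.L2Operator in
theorem aux_det_mono {ι : Type*} [Fintype ι] [DecidableEq ι] {A P : Matrix ι ι ℝ}
    (hA : A.PosDef) (hP : P.PosSemidef) : A.det ≤ (A + P).det := by
  obtain ⟨B, rfl⟩ := CStarAlgebra.nonneg_iff_eq_star_mul_self.mp hP.nonneg
  rw [star_eq_conjTranspose, det_add_mul _ _ ((isUnit_iff_isUnit_det _).1 hA.isUnit)]
  have h := aux_one_le_det (hA.inv.posSemidef.mul_mul_conjTranspose_same B)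
  nlinarith [hA.det_pos]

/-- Real form of the uncertainty relation. -/
theorem aux_real {ι : Type*} [Fintype ι] [DecidableEq ι] {Om V : Matrix ι ι ℝ}
    (hOm : Omᵀ = -Om) (hV : V.PosDef) (h : QCM Om V) :
    (V - Om * V⁻¹ * Omᵀ).PosSemidef := by
  have hVT : Vᵀ = V := by simpa using hV.1.eq
  have hu := (isUnit_iff_isUnit_det _).1 hV.isUnit
  refine PosSemidef.of_dotProduct_mulVec_nonneg ?_ ?_
  · refine hV.1.sub ?_
    have := hV.inv.posSemidef.mul_mul_conjTranspose_same Om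
    simpa using this.1
  intro a
  have key : ∀ b : ι → ℝ, 0 ≤ a ⬝ᵥ V *ᵥ a + b ⬝ᵥ V *ᵥ b - a ⬝ᵥ Om *ᵥ b + b ⬝ᵥ Om *ᵥ a := by
    intro b
    have h2 := h.re_dotProduct_nonneg (fun i => (a i : ℂ) + Complex.I * (b i : ℂ))
    have e : RCLike.re (star (fun i => (a i : ℂ) + Complex.I * (b i : ℂ)) ⬝ᵥ
      ((V.map Complex.ofReal + Complex.I • Om.map Complex.ofReal) *ᵥ
        (fun i => (a i : ℂ) + Complex.I * (b i : ℂ)))) =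
        a ⬝ᵥ V *ᵥ a + b ⬝ᵥ V *ᵥ b - a ⬝ᵥ Om *ᵥ b + b ⬝ᵥ Om *ᵥ a := by
      simp only [dotProduct, mulVec, Finset.mul_sum, map_sum, ← Finset.sum_add_distrib,
        ← Finset.sum_sub_distrib]
      refine Finset.sum_congr rfl fun i _ => Finset.sum_congr rfl fun j _ => ?_
      simp
      ring
    rwa [e] at h2
  have hk := key (V⁻¹ *ᵥ (Omᵀ *ᵥ a))
  have hk2 := key (-(V⁻¹ *ᵥ (Omᵀ *ᵥ a)))
  set b := V⁻¹ *ᵥ (Omᵀ *ᵥ a) with hb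
  have e0 : V *ᵥ b = Omᵀ *ᵥ a := by
    rw [hb, mulVec_mulVec, mul_nonsing_inv _ hu, one_mulVec]
  have e1 : b ⬝ᵥ V *ᵥ b = a ⬝ᵥ Om *ᵥ b := by
    rw [e0, dotProduct_comm, mulVec_transpose, ← dotProduct_mulVec]
  have e2 : b ⬝ᵥ Om *ᵥ a = - (a ⬝ᵥ Om *ᵥ b) := by
    rw [← e1, e0, hOm, neg_mulVec, dotProduct_neg, neg_neg]
  have e3 : star a ⬝ᵥ (V - Om * V⁻¹ * Omᵀ) *ᵥ a = a ⬝ᵥ V *ᵥ a - a ⬝ᵥ Om *ᵥ b := by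
    rw [sub_mulVec, dotProduct_sub, hb]
    simp [← mulVec_mulVec]
  rw [e3]
  rw [e1, e2] at hk
  linarith

theorem aux_Omega_transpose (n : ℕ) : (Omega n)ᵀ = - Omega n := by
  ext ⟨i, x⟩ ⟨j, y⟩
  fin_cases x <;> fin_cases y <;> simp [Omega, J2, Matrix.one_apply, eq_comm]

theorem aux_Omega_mul (n : ℕ) : Omega n * (Omega n)ᵀ = 1 := by
  have h : J2 * J2ᵀ = 1 := by
    ext i j
    fin_cases i <;> fin_cases j <;> simp [J2, Matrix.mul_apply]
  rw [Omega, ← kroneckerMap_transpose, transpose_one, ← mul_kronecker_mul, h]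
  simp

/-- **Determinant decreases under pure Gaussian measurements.** Let `Z > 0` be real
symmetric on `B ⊕ C` with `Z + i·Ω_{BC} ≥ 0`, and let `γ > 0` be real symmetric and
symplectic on `C`. Then `det((Z + 0_B ⊕ γ)/(Z_C + γ)) ≤ det Z`. -/
theorem det_decreases_pure_measurement (nB nC : ℕ)
    (Z : Matrix ((Fin nB × Fin 2) ⊕ (Fin nC × Fin 2))
        ((Fin nB × Fin 2) ⊕ (Fin nC × Fin 2)) ℝ)
    (γ : Matrix (Fin nC × Fin 2) (Fin nC × Fin 2) ℝ)
    (hZsymm : Z.IsSymm) (hZpd : Z.PosDef)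
    (hQCM : QCM (fromBlocks (Omega nB) 0 0 (Omega nC)) Z)
    (hγsymm : γ.IsSymm) (hγpd : γ.PosDef) (hγsymp : γ * Omega nC * γᵀ = Omega nC) :
    (schurB (Z + fromBlocks 0 0 0 γ)).det ≤ Z.det := by
  have hOC := aux_Omega_mul nC
  have hOC' : (Omega nC)ᵀ * Omega nC = 1 := mul_eq_one_comm.mp hOC
  have hOT : (fromBlocks (Omega nB) 0 0 (Omega nC))ᵀ =
      -(fromBlocks (Omega nB) 0 0 (Omega nC)) := by
    rw [fromBlocks_transpose, aux_Omega_transpose, aux_Omega_transpose, fromBlocks_neg]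
    simp
  have hR := aux_real hOT hZpd hQCM
  have hγu := (isUnit_iff_isUnit_det _).1 hγpd.isUnit
  have hZu := (isUnit_iff_isUnit_det _).1 hZpd.isUnit
  have hγT : γᵀ = γ := hγsymm
  set W := (Z⁻¹).toBlocks₂₂ with hW
  have hWpd : W.PosDef := hZpd.inv.submatrix Sum.inr_injective
  have hZC : Z.toBlocks₂₂.PosDef := hZpd.submatrix Sum.inr_injective
  have hZCg : (Z.toBlocks₂₂ + γ).PosDef := hZC.add hγpd
  -- the C block of the uncertainty relation
  have hRC : (Z.toBlocks₂₂ - Omega nC * W * (Omega nC)ᵀ).PosSemidef := by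
    have := hR.submatrix (Sum.inr : (Fin nC × Fin 2) → _)
    convert this using 1
    have e : fromBlocks (Omega nB) 0 0 (Omega nC) * Z⁻¹ *
        (fromBlocks (Omega nB) 0 0 (Omega nC))ᵀ = fromBlocks
          (Omega nB * (Z⁻¹).toBlocks₁₁ * (Omega nB)ᵀ) (Omega nB * (Z⁻¹).toBlocks₁₂ * (Omega nC)ᵀ)
          (Omega nC * (Z⁻¹).toBlocks₂₁ * (Omega nB)ᵀ) (Omega nC * W * (Omega nC)ᵀ) := by
      conv_lhs => rw [← fromBlocks_toBlocks Z⁻¹]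
      rw [fromBlocks_transpose, fromBlocks_multiply, fromBlocks_multiply]
      simp [hW]
    rw [e]
    rfl
  -- γ⁻¹ = Ωᵀ γ Ω
  have hg : γ⁻¹ = (Omega nC)ᵀ * γ * Omega nC := by
    apply inv_eq_left_inv
    rw [hγT] at hγsymp
    rw [Matrix.mul_assoc, Matrix.mul_assoc, ← Matrix.mul_assoc γ, hγsymp, hOC']
  have hdO : (Omega nC).det * (Omega nC).det = 1 := by
    have := congrArg det hOC
    rwa [det_mul, det_transpose, det_one] at this
  have hdγ : γ.det = 1 := by
    have h1 := congrArg det hγsymp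
    rw [det_mul, det_mul, det_transpose] at h1
    have h2 : (Omega nC).det ≠ 0 := by
      intro h0; simp [h0] at hdO
    have h3 : γ.det * γ.det = 1 := by
      apply mul_right_cancel₀ h2; linarith
    nlinarith [hγpd.det_pos]
  have hOWpd : (Omega nC * W * (Omega nC)ᵀ + γ).PosDef := by
    refine PosDef.posSemidef_add ?_ hγpd
    simpa using hWpd.posSemidef.mul_mul_conjTranspose_same (Omega nC)
  have hle : (1 + W * γ).det ≤ (Z.toBlocks₂₂ + γ).det := by
    have h1 := aux_det_mono hOWpd hRC
    have e1 : Omega nC * W * (Omega nC)ᵀ + γ + (Z.toBlocks₂₂ - Omega nC * W * (Omega nC)ᵀ)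
        = Z.toBlocks₂₂ + γ := by abel
    rw [e1] at h1
    have e2 : (1 + W * γ) = (γ⁻¹ + W) * γ := by
      rw [Matrix.add_mul, nonsing_inv_mul _ hγu]
    have e3 : Omega nC * W * (Omega nC)ᵀ + γ = Omega nC * (γ⁻¹ + W) * (Omega nC)ᵀ := by
      have : Omega nC * ((Omega nC)ᵀ * γ * Omega nC) * (Omega nC)ᵀ = γ := by
        calc _ = (Omega nC * (Omega nC)ᵀ) * γ * (Omega nC * (Omega nC)ᵀ) := by
              simp only [Matrix.mul_assoc]
          _ = γ := by rw [hOC]; simp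
      rw [hg, Matrix.mul_add, Matrix.add_mul, this, add_comm]
    have e4 : (1 + W * γ).det = (Omega nC * W * (Omega nC)ᵀ + γ).det := by
      rw [e2, e3, det_mul, det_mul, det_mul, det_transpose, hdγ]
      linear_combination (-(γ⁻¹ + W).det) * hdO
    rw [e4]; exact h1
  have hdet1 : (Z + fromBlocks 0 0 0 γ).det = Z.det * (1 + W * γ).det := by
    have e : (fromBlocks 0 0 0 γ : Matrix ((Fin nB × Fin 2) ⊕ (Fin nC × Fin 2))
        ((Fin nB × Fin 2) ⊕ (Fin nC × Fin 2)) ℝ) =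
        (fromRows 0 γ : Matrix ((Fin nB × Fin 2) ⊕ (Fin nC × Fin 2)) (Fin nC × Fin 2) ℝ) *
        (fromCols 0 1 : Matrix (Fin nC × Fin 2) ((Fin nB × Fin 2) ⊕ (Fin nC × Fin 2)) ℝ) := by
      rw [fromRows_mul_fromCols]; simp
    rw [e, det_add_mul _ _ hZu]
    congr 2
    conv_lhs => rw [← fromBlocks_toBlocks Z⁻¹]
    rw [fromCols_mul_fromBlocks, fromCols_mul_fromRows]
    simp [hW]
  have hdet2 : (Z + fromBlocks 0 0 0 γ).det =
      (Z.toBlocks₂₂ + γ).det * (schurB (Z + fromBlocks 0 0 0 γ)).det := by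
    have e22 : (Z + fromBlocks 0 0 0 γ).toBlocks₂₂ = Z.toBlocks₂₂ + γ := rfl
    have : Invertible (Z + fromBlocks 0 0 0 γ).toBlocks₂₂ := by
      rw [e22]; exact hZCg.isUnit.invertible
    conv_lhs => rw [← fromBlocks_toBlocks (Z + fromBlocks 0 0 0 γ)]
    rw [det_fromBlocks₂₂, invOf_eq_nonsing_inv, schurB, e22]
  have hp := hZCg.det_pos
  have hz := hZpd.det_pos
  refine le_of_mul_le_mul_left ?_ hp
  rw [← hdet2, hdet1, mul_comm]
  exact mul_le_mul_of_nonneg_right hle hz.le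

end
end

section
/- Monogamy of the Gaussian Rényi-2 entanglement: for a real symmetric positive definite quantum covariance matrix W on subsystems X ⊕ Y, define E_2(X:Y)_W = inf { ½ log det γ_X : γ real symmetric positive definite symplectic on X ⊕ Y with γ ≤ W }, where γ_X is the X-diagonal block. Then for every real symmetric positive definite quantum covariance matrix V on three subsystems A ⊕ B ⊕ C (V + i·(Ω_{n_A} ⊕ Ω_{n_B} ⊕ Ω_{n_C}) positive semidefinite), one has E_2(A:BC)_V ≥ E_2(A:B)_{V_{AB}} + E_2(A:C)_{V_{AC}}, where V_{AB}, V_{AC} are the indicated principal submatrices. -/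
open Matrix
open scoped ComplexOrder Kronecker

noncomputable section

/-- The Gaussian Rényi-2 entanglement `E₂(X:Y)_W` of a quantum covariance matrix `W` on
`X ⊕ Y` (w.r.t. the symplectic form `Om` of `X ⊕ Y`): the infimum of `½ log det γ_X` over
real symmetric positive definite symplectic matrices `γ ≤ W`. -/
def E2 {x y : Type*} [Fintype x] [Fintype y] [DecidableEq x] [DecidableEq y]
    (Om W : Matrix (x ⊕ y) (x ⊕ y) ℝ) : ℝ :=
  sInf { r : ℝ | ∃ γ : Matrix (x ⊕ y) (x ⊕ y) ℝ,
    γ.IsSymm ∧ γ.PosDef ∧ γ * Om * γᵀ = Om ∧ (W - γ).PosSemidef ∧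
    r = (1 / 2) * Real.log γ.toBlocks₁₁.det }


namespace R2
section
open scoped MatrixOrder
set_option linter.unusedSectionVars false

variable {m n k : Type*} [Fintype m] [Fintype n] [Fintype k]
  [DecidableEq m] [DecidableEq n] [DecidableEq k]

lemma exists_sqrt {P : Matrix n n ℝ} (hP : P.PosDef) :
    ∃ R : Matrix n n ℝ, R.PosDef ∧ R * R = P := by
  have h0 : (0 : Matrix n n ℝ) ≤ P := hP.posSemidef.nonneg
  have h1 : CFC.sqrt P * CFC.sqrt P = P := CFC.sqrt_mul_sqrt_self P h0
  refine ⟨CFC.sqrt P, ?_, h1⟩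
  rw [(LE.le.posSemidef (CFC.sqrt_nonneg P)).posDef_iff_det_ne_zero]
  intro h
  have := hP.det_pos
  rw [← h1, det_mul, h] at this
  simp at this

lemma sqrt_uniq {X Y : Matrix n n ℝ} (hX : X.PosSemidef) (hY : Y.PosSemidef)
    (h : X * X = Y * Y) : X = Y := by
  rw [← CFC.sqrt_mul_self X hX.nonneg, ← CFC.sqrt_mul_self Y hY.nonneg, h]

lemma one_le_det {M : Matrix n n ℝ} (hM : M.PosSemidef) : 1 ≤ (1 + M).det := by
  have hs := hM.1.spectral_theorem
  set U := hM.1.eigenvectorUnitary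
  have hUU : (U : Matrix n n ℝ) * star (U : Matrix n n ℝ) = 1 := Unitary.coe_mul_star_self U
  have h1 : 1 + M = (U : Matrix n n ℝ) * (1 + diagonal (hM.1.eigenvalues)) *
      star (U : Matrix n n ℝ) := by
    conv_lhs => rw [hs]
    rw [mul_add, add_mul, mul_one, hUU]
    rfl
  have h2 : (1 + diagonal (hM.1.eigenvalues) : Matrix n n ℝ) =
      diagonal (fun i => 1 + hM.1.eigenvalues i) := by
    rw [← diagonal_one, diagonal_add]
  rw [h1, det_mul_right_comm, hUU, one_mul, h2, det_diagonal]
  have : ∀ i ∈ Finset.univ, 1 ≤ 1 + hM.1.eigenvalues i := fun i _ => by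
    have := hM.eigenvalues_nonneg i
    linarith
  calc (1 : ℝ) = ∏ i : n, 1 := by simp
    _ ≤ _ := Finset.prod_le_prod (by simp) this

lemma conj_posDef {P T : Matrix n n ℝ} (hP : P.PosDef) (hT : IsUnit T) :
    (T * P * Tᵀ).PosDef := by
  have := (Matrix.IsUnit.posDef_star_right_conjugate_iff (x := P) hT).2 hP
  rwa [star_eq_conjTranspose, conjTranspose_eq_transpose_of_trivial] at this

lemma symm_of {P : Matrix n n ℝ} (hP : P.IsHermitian) : Pᵀ = P := by
  have := hP
  rwa [IsHermitian, conjTranspose_eq_transpose_of_trivial] at this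

lemma det_mono {A B : Matrix n n ℝ} (hA : A.PosDef) (hAB : (B - A).PosSemidef) :
    A.det ≤ B.det := by
  obtain ⟨R, hR, rfl⟩ := exists_sqrt hA
  have hu : IsUnit R.det := hR.det_pos.ne'.isUnit
  have hM : (R⁻¹ * (B - R * R) * R⁻¹).PosSemidef := by
    have := hAB.mul_mul_conjTranspose_same R⁻¹
    rwa [hR.inv.1.eq] at this
  have h1 := one_le_det hM
  have h2 : R * (1 + R⁻¹ * (B - R * R) * R⁻¹) * R = B := by
    have e1 : R * R⁻¹ = 1 := mul_nonsing_inv _ hu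
    have e2 : R⁻¹ * R = 1 := nonsing_inv_mul _ hu
    calc _ = R * R + (R * R⁻¹) * (B - R * R) * (R⁻¹ * R) := by noncomm_ring
      _ = B := by rw [e1, e2]; noncomm_ring
  rw [← h2, det_mul, det_mul, det_mul]
  nlinarith [mul_pos hR.det_pos hR.det_pos]

lemma psd_fromBlocks_iff {A : Matrix m m ℝ} {B : Matrix m n ℝ} {D : Matrix n n ℝ}
    (hA : A.PosDef) : (fromBlocks A B Bᵀ D).PosSemidef ↔ (D - Bᵀ * A⁻¹ * B).PosSemidef := by
  have := hA.isUnit.invertible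
  have := Matrix.PosDef.fromBlocks₁₁ (A := A) B D hA
  rwa [conjTranspose_eq_transpose_of_trivial] at this

/-- Determinant Cauchy–Schwarz. -/
lemma det_cs {A G D : Matrix n n ℝ} (hA : A.PosDef) (hG : IsUnit G)
    (h : (fromBlocks A G Gᵀ D).PosSemidef) : G.det ^ 2 ≤ A.det * D.det := by
  rw [psd_fromBlocks_iff hA] at h
  have h1 : (Gᵀ * A⁻¹ * G).PosDef := by
    have := conj_posDef (T := Gᵀ) hA.inv ((isUnit_transpose _).2 hG)
    rwa [transpose_transpose] at this
  have h2 := det_mono h1 h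
  rw [det_mul, det_mul, det_transpose, det_nonsing_inv, Ring.inverse_eq_inv'] at h2
  have h3 := hA.det_pos
  have h4 : A.det * (G.det * A.det⁻¹ * G.det) = G.det ^ 2 := by field_simp
  rw [← h4]
  exact mul_le_mul_of_nonneg_left h2 h3.le

/-- Geometric mean: existence and uniqueness of the PD solution of `G P⁻¹ G = Q`. -/
lemma geom_exists {P Q : Matrix n n ℝ} (hP : P.PosDef) (hQ : Q.PosDef) :
    ∃ G : Matrix n n ℝ, G.PosDef ∧ G * P⁻¹ * G = Q := by
  obtain ⟨R, hR, rfl⟩ := exists_sqrt hP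
  have hu : IsUnit R.det := hR.det_pos.ne'.isUnit
  have e1 : R * R⁻¹ = 1 := mul_nonsing_inv _ hu
  have e2 : R⁻¹ * R = 1 := nonsing_inv_mul _ hu
  have hRt : Rᵀ = R := symm_of hR.1
  have hM : (R⁻¹ * Q * R⁻¹).PosDef := by
    have := conj_posDef hQ hR.inv.isUnit
    rwa [symm_of hR.inv.1] at this
  obtain ⟨S, hS, hSS⟩ := exists_sqrt hM
  refine ⟨R * S * R, ?_, ?_⟩
  · have := conj_posDef hS hR.isUnit
    rwa [hRt] at this
  · rw [Matrix.mul_inv_rev]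
    calc R * S * R * (R⁻¹ * R⁻¹) * (R * S * R)
        = R * S * (R * R⁻¹) * (R⁻¹ * R) * S * R := by noncomm_ring
      _ = R * (S * S) * R := by rw [e1, e2]; noncomm_ring
      _ = (R * R⁻¹) * Q * (R⁻¹ * R) := by rw [hSS]; noncomm_ring
      _ = Q := by rw [e1, e2]; noncomm_ring

lemma geom_unique {P G H : Matrix n n ℝ} (hP : P.PosDef) (hG : G.PosDef) (hH : H.PosDef)
    (h : G * P⁻¹ * G = H * P⁻¹ * H) : G = H := by
  obtain ⟨R, hR, hRR⟩ := exists_sqrt hP.inv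
  have hu : IsUnit R.det := hR.det_pos.ne'.isUnit
  have e1 : R * R⁻¹ = 1 := mul_nonsing_inv _ hu
  have e2 : R⁻¹ * R = 1 := nonsing_inv_mul _ hu
  have hRt : Rᵀ = R := symm_of hR.1
  have key : R * G * R = R * H * R := by
    apply sqrt_uniq
    · have := conj_posDef hG hR.isUnit
      rw [hRt] at this; exact this.posSemidef
    · have := conj_posDef hH hR.isUnit
      rw [hRt] at this; exact this.posSemidef
    · rw [← hRR] at h
      calc R * G * R * (R * G * R) = R * (G * (R * R) * G) * R := by noncomm_ring
        _ = R * H * R * (R * H * R) := by rw [h]; noncomm_ring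
  calc G = (R⁻¹ * R) * G * (R * R⁻¹) := by rw [e1, e2]; simp
    _ = R⁻¹ * (R * G * R) * R⁻¹ := by noncomm_ring
    _ = (R⁻¹ * R) * H * (R * R⁻¹) := by rw [key]; noncomm_ring
    _ = H := by rw [e1, e2]; simp

/-- Real form of the uncertainty relation. -/
def RQ (Om W : Matrix n n ℝ) : Prop := (fromBlocks W Om Omᵀ W).PosSemidef

structure IsForm (Om : Matrix n n ℝ) : Prop where
  skew : Omᵀ = -Om
  sq : Om * Om = -1

lemma IsForm.unit {Om : Matrix n n ℝ} (h : IsForm Om) : IsUnit Om := by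
  refine IsUnit.of_mul_eq_one (-Om) ?_
  rw [mul_neg, h.sq, neg_neg]

lemma IsForm.mulT {Om : Matrix n n ℝ} (h : IsForm Om) : Om * Omᵀ = 1 := by
  rw [h.skew, mul_neg, h.sq, neg_neg]

lemma IsForm.Tmul {Om : Matrix n n ℝ} (h : IsForm Om) : Omᵀ * Om = 1 := by
  rw [h.skew, neg_mul, h.sq, neg_neg]

lemma IsForm.det_sq {Om : Matrix n n ℝ} (h : IsForm Om) : Om.det ^ 2 = 1 := by
  have := congrArg det h.mulT
  rw [det_mul, det_transpose, det_one] at this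
  rw [_root_.sq, this]

lemma pure_exists {Om W : Matrix n n ℝ} (hO : IsForm Om) (hW : W.PosDef) (hR : RQ Om W) :
    ∃ G : Matrix n n ℝ, G.PosDef ∧ G * Om * Gᵀ = Om ∧ (W - G).PosSemidef ∧
      (fromBlocks W G Gᵀ (Omᵀ * W⁻¹ * Om)).PosSemidef := by
  have hQ : (Omᵀ * W⁻¹ * Om).PosDef := by
    have := conj_posDef (T := Omᵀ) hW.inv ((isUnit_transpose _).2 hO.unit)
    rwa [transpose_transpose] at this
  obtain ⟨G, hG, hGQ⟩ := geom_exists hW hQ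
  have hGt : Gᵀ = G := symm_of hG.1
  have hu : IsUnit G.det := hG.det_pos.ne'.isUnit
  have e1 : G * G⁻¹ = 1 := mul_nonsing_inv _ hu
  have e2 : G⁻¹ * G = 1 := nonsing_inv_mul _ hu
  have hB : (fromBlocks W G Gᵀ (Omᵀ * W⁻¹ * Om)).PosSemidef := by
    rw [psd_fromBlocks_iff hW, hGt, hGQ, sub_self]
    exact PosSemidef.zero
  refine ⟨G, hG, ?_, ?_, hB⟩
  · have hX : Omᵀ * G⁻¹ * Om = G := by
      apply geom_unique hW ?_ hG
      · rw [hGQ]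
        have hinv : G⁻¹ * (Omᵀ * W⁻¹ * Om) * G⁻¹ = W⁻¹ := by
          rw [← hGQ]
          calc _ = (G⁻¹ * G) * W⁻¹ * (G * G⁻¹) := by noncomm_ring
            _ = _ := by rw [e1, e2]; simp
        have hT : Om * W⁻¹ * Omᵀ = Omᵀ * W⁻¹ * Om := by
          rw [hO.skew]; noncomm_ring
        calc _ = Omᵀ * (G⁻¹ * (Om * W⁻¹ * Omᵀ) * G⁻¹) * Om := by noncomm_ring
          _ = _ := by rw [hT, hinv]
      · have := conj_posDef (T := Omᵀ) hG.inv ((isUnit_transpose _).2 hO.unit)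
        rwa [transpose_transpose] at this
    rw [hGt]
    have hX' : G * Om = Om * G⁻¹ := by
      have hT : Om * G⁻¹ * Omᵀ = Omᵀ * G⁻¹ * Om := by
        rw [hO.skew]; noncomm_ring
      rw [← hT] at hX
      calc G * Om = (Om * G⁻¹ * Omᵀ) * Om := by rw [hX]
        _ = Om * G⁻¹ * (Omᵀ * Om) := by noncomm_ring
        _ = _ := by rw [hO.Tmul, mul_one]
    rw [hX', mul_assoc, e2, mul_one]
  · have h2 : (W - Omᵀ * W⁻¹ * Om).PosSemidef := (psd_fromBlocks_iff hW).1 hR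
    refine .of_dotProduct_mulVec_nonneg (hW.1.sub hG.1) fun x => ?_
    have h3 := hB.dotProduct_mulVec_nonneg (Sum.elim x (-x))
    have h4 := h2.dotProduct_mulVec_nonneg x
    rw [hGt] at h3
    simp only [star_trivial, fromBlocks_mulVec, Sum.elim_comp_inl, Sum.elim_comp_inr,
      sumElim_dotProduct_sumElim, mulVec_neg, neg_dotProduct, dotProduct_add, dotProduct_neg, sub_mulVec,
      dotProduct_sub] at h3 h4 ⊢
    linarith

lemma RQ.sub {Om W : Matrix n n ℝ} (h : RQ Om W) (e : m → n) :
    RQ (Om.submatrix e e) (W.submatrix e e) := by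
  have := PosSemidef.submatrix h (Sum.map e e)
  unfold RQ
  convert this using 1
  ext (i | i) (j | j) <;> rfl

lemma RQ_of_pure {Om G : Matrix n n ℝ} (hO : IsForm Om) (hG : G.PosDef)
    (h : G * Om * Gᵀ = Om) : RQ Om G := by
  unfold RQ
  rw [psd_fromBlocks_iff hG]
  have hu : IsUnit G.det := hG.det_pos.ne'.isUnit
  have e2 : G⁻¹ * G = 1 := nonsing_inv_mul _ hu
  rw [symm_of hG.1] at h
  have : Omᵀ * G⁻¹ * Om = G := by
    calc _ = Omᵀ * G⁻¹ * (G * Om * G) := by rw [h]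
      _ = Omᵀ * (G⁻¹ * G) * Om * G := by noncomm_ring
      _ = G := by rw [e2, mul_one, hO.Tmul, one_mul]
  rw [this, sub_self]
  exact PosSemidef.zero

lemma RQ_of_QCM {Om V : Matrix n n ℝ} (hO : Omᵀ = -Om) (hV : V.IsHermitian) (h : QCM Om V) :
    RQ Om V := by
  unfold RQ
  refine .of_dotProduct_mulVec_nonneg ?_ fun x => ?_
  · exact IsHermitian.fromBlocks hV (conjTranspose_eq_transpose_of_trivial _) hV
  · have h1 := PosSemidef.re_dotProduct_nonneg h
      (fun i => (x (Sum.inl i) : ℂ) - Complex.I * x (Sum.inr i))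
    have hsk : ∀ i j, Om j i = - Om i j := fun i j => congrFun (congrFun hO i) j
    refine h1.trans_eq (Eq.symm ?_)
    simp only [dotProduct, mulVec, Fintype.sum_sum_type, fromBlocks_apply₁₁, fromBlocks_apply₁₂,
      fromBlocks_apply₂₁, fromBlocks_apply₂₂, map_sum, Finset.mul_sum, mul_add, ← Finset.sum_add_distrib,
      transpose_apply]
    refine Finset.sum_congr rfl fun i _ => Finset.sum_congr rfl fun j _ => ?_
    simp [hsk i j]
    ring

lemma jacobi (M N : Matrix (m ⊕ n) (m ⊕ n) ℝ) (h : M * N = 1) :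
    M.det * N.toBlocks₁₁.det = M.toBlocks₂₂.det := by
  have h1 : M * fromBlocks N.toBlocks₁₁ 0 N.toBlocks₂₁ 1 =
      fromBlocks 1 M.toBlocks₁₂ 0 M.toBlocks₂₂ := by
    rw [← fromBlocks_toBlocks M, ← fromBlocks_toBlocks N, fromBlocks_multiply, ← fromBlocks_one,
      fromBlocks_inj] at h
    conv_lhs => rw [← fromBlocks_toBlocks M]
    rw [fromBlocks_multiply, h.1, h.2.2.1]
    simp
  have := congrArg det h1
  rw [det_mul, det_fromBlocks_zero₁₂, det_fromBlocks_zero₂₁] at this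
  simpa using this

lemma IsForm.blocks {O1 : Matrix m m ℝ} {O2 : Matrix n n ℝ} (h1 : IsForm O1) (h2 : IsForm O2) :
    IsForm (fromBlocks O1 0 0 O2) := by
  constructor
  · rw [fromBlocks_transpose, fromBlocks_neg, h1.skew, h2.skew]; simp
  · rw [fromBlocks_multiply, ← fromBlocks_one, fromBlocks_neg]
    simp [h1.sq, h2.sq]

lemma conj_block_det {O1 : Matrix m m ℝ} {O2 : Matrix n n ℝ} (h1 : IsForm O1)
    (N : Matrix (m ⊕ n) (m ⊕ n) ℝ) :
    ((fromBlocks O1 0 0 O2)ᵀ * N * fromBlocks O1 0 0 O2).toBlocks₁₁.det = N.toBlocks₁₁.det := by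
  have : ((fromBlocks O1 0 0 O2)ᵀ * N * fromBlocks O1 0 0 O2).toBlocks₁₁ =
      O1ᵀ * N.toBlocks₁₁ * O1 := by
    conv_lhs => rw [← fromBlocks_toBlocks N]
    rw [fromBlocks_transpose, fromBlocks_multiply, fromBlocks_multiply]
    simp
  rw [this, det_mul, det_mul, det_transpose]
  have := h1.det_sq
  linear_combination (N.toBlocks₁₁.det) * this

lemma pure_det {O1 : Matrix m m ℝ} {O2 : Matrix n n ℝ} (h1 : IsForm O1) (h2 : IsForm O2)
    {G : Matrix (m ⊕ n) (m ⊕ n) ℝ} (hG : G.PosDef)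
    (h : G * fromBlocks O1 0 0 O2 * Gᵀ = fromBlocks O1 0 0 O2) :
    G.toBlocks₁₁.det = G.toBlocks₂₂.det := by
  have hO := h1.blocks h2
  have hd : G.det = 1 := by
    have e := congrArg det h
    rw [det_mul, det_mul, det_transpose] at e
    have e' : (fromBlocks O1 0 0 O2).det ≠ 0 := by
      intro h0
      have := hO.det_sq
      rw [h0] at this; norm_num at this
    have e2 : G.det ^ 2 = 1 := by
      apply mul_left_cancel₀ e'
      linear_combination e
    nlinarith [hG.det_pos]
  have hinv : G * ((fromBlocks O1 0 0 O2)ᵀ * G * fromBlocks O1 0 0 O2) = 1 := by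
    rw [symm_of hG.1] at h
    rw [hO.skew]
    calc _ = - ((G * fromBlocks O1 0 0 O2 * G) * fromBlocks O1 0 0 O2) := by noncomm_ring
      _ = 1 := by rw [h, hO.sq, neg_neg]
  have := jacobi _ _ hinv
  rwa [hd, one_mul, conj_block_det h1] at this

lemma RQ.one_le {Om W : Matrix n n ℝ} (hO : IsForm Om) (hW : W.PosDef) (h : RQ Om W) :
    1 ≤ W.det := by
  have h1 := det_cs hW hO.unit h
  rw [hO.det_sq] at h1
  nlinarith [hW.det_pos]

lemma E2_le {O1 : Matrix m m ℝ} {O2 : Matrix n n ℝ} (h1 : IsForm O1) (h2 : IsForm O2)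
    {W W' : Matrix (m ⊕ n) (m ⊕ n) ℝ} (hW' : W'.PosDef)
    (hR : RQ (fromBlocks O1 0 0 O2) W') (hle : (W - W').PosSemidef) :
    E2 (fromBlocks O1 0 0 O2) W ≤
      (1 / 4) * Real.log (W'.toBlocks₁₁.det * W'.toBlocks₂₂.det / W'.det) := by
  have hO := h1.blocks h2
  obtain ⟨G, hG, hGO, hGW, hB⟩ := pure_exists hO hW' hR
  have hG1 : G.toBlocks₁₁.PosDef := hG.submatrix Sum.inl_injective
  have hW1 : W'.toBlocks₁₁.PosDef := hW'.submatrix Sum.inl_injective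
  have hmem : (1 / 2) * Real.log G.toBlocks₁₁.det ∈ { r : ℝ | ∃ γ : Matrix (m ⊕ n) (m ⊕ n) ℝ,
    γ.IsSymm ∧ γ.PosDef ∧ γ * (fromBlocks O1 0 0 O2) * γᵀ = (fromBlocks O1 0 0 O2) ∧
    (W - γ).PosSemidef ∧ r = (1 / 2) * Real.log γ.toBlocks₁₁.det } := by
    refine ⟨G, symm_of hG.1, hG, hGO, ?_, rfl⟩
    have := hle.add hGW
    rwa [sub_add_sub_cancel] at this
  have hbdd : BddBelow { r : ℝ | ∃ γ : Matrix (m ⊕ n) (m ⊕ n) ℝ,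
    γ.IsSymm ∧ γ.PosDef ∧ γ * (fromBlocks O1 0 0 O2) * γᵀ = (fromBlocks O1 0 0 O2) ∧
    (W - γ).PosSemidef ∧ r = (1 / 2) * Real.log γ.toBlocks₁₁.det } := by
    refine ⟨0, ?_⟩
    rintro r ⟨γ, -, hγ, hγO, -, rfl⟩
    have hr := (RQ_of_pure hO hγ hγO).sub Sum.inl
    have : 1 ≤ γ.toBlocks₁₁.det := RQ.one_le h1 (hγ.submatrix Sum.inl_injective) hr
    have := Real.log_nonneg this
    positivity
  refine (csInf_le hbdd hmem).trans ?_
  have hB1 : (fromBlocks W'.toBlocks₁₁ G.toBlocks₁₁ G.toBlocks₁₁ᵀ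
      ((fromBlocks O1 0 0 O2)ᵀ * W'⁻¹ * fromBlocks O1 0 0 O2).toBlocks₁₁).PosSemidef := by
    have := hB.submatrix (Sum.map Sum.inl Sum.inl : m ⊕ m → (m ⊕ n) ⊕ (m ⊕ n))
    convert this using 1
    ext (i | i) (j | j) <;> rfl
  have hd := det_cs hW1 hG1.isUnit hB1
  rw [conj_block_det h1] at hd
  have hp := hW'.det_pos
  have hj := jacobi W' W'⁻¹ (mul_nonsing_inv _ hp.ne'.isUnit)
  have hj' : W'⁻¹.toBlocks₁₁.det = W'.toBlocks₂₂.det / W'.det := by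
    rw [← hj]; field_simp
  rw [hj', ← mul_div_assoc] at hd
  have hl := Real.log_le_log (pow_pos hG1.det_pos 2) hd
  rw [Real.log_pow] at hl
  push_cast at hl
  linarith

lemma Omega_form (n : ℕ) : IsForm (Omega n) := by
  have hJ : J2ᵀ = -J2 := by
    ext i j; fin_cases i <;> fin_cases j <;> simp [J2]
  have hJ2 : J2 * J2 = -1 := by
    ext i j; fin_cases i <;> fin_cases j <;> simp [J2]
  constructor
  · unfold Omega
    rw [← kroneckerMap_transpose, hJ, transpose_one]
    ext i j; simp
  · unfold Omega
    rw [← mul_kronecker_mul, hJ2, one_mul]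
    ext i j
    simp [one_apply, Prod.ext_iff]
    grind

lemma pure_bound {a b c : Type*} [Fintype a] [Fintype b] [Fintype c]
    [DecidableEq a] [DecidableEq b] [DecidableEq c]
    {Oa : Matrix a a ℝ} {Ob : Matrix b b ℝ} {Oc : Matrix c c ℝ}
    (ha : IsForm Oa) (hb : IsForm Ob) (hc : IsForm Oc)
    {V γ : Matrix (a ⊕ (b ⊕ c)) (a ⊕ (b ⊕ c)) ℝ}
    (hγ : γ.PosDef)
    (hγO : γ * fromBlocks Oa 0 0 (fromBlocks Ob 0 0 Oc) * γᵀ =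
      fromBlocks Oa 0 0 (fromBlocks Ob 0 0 Oc)) (hle : (V - γ).PosSemidef) :
    E2 (fromBlocks Oa 0 0 Ob) (V.submatrix embAB embAB) +
      E2 (fromBlocks Oa 0 0 Oc) (V.submatrix embAC embAC) ≤
      (1 / 2) * Real.log γ.toBlocks₁₁.det := by
  have hR := RQ_of_pure (ha.blocks (hb.blocks hc)) hγ hγO
  have iAB : Function.Injective (embAB : a ⊕ b → a ⊕ (b ⊕ c)) := by
    rintro (i | i) (j | j) h <;> simp_all [embAB]
  have iAC : Function.Injective (embAC : a ⊕ c → a ⊕ (b ⊕ c)) := by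
    rintro (i | i) (j | j) h <;> simp_all [embAC]
  have oAB : (fromBlocks Oa 0 0 (fromBlocks Ob 0 0 Oc)).submatrix embAB embAB =
      fromBlocks Oa 0 0 Ob := by
    ext (i | i) (j | j) <;> rfl
  have oAC : (fromBlocks Oa 0 0 (fromBlocks Ob 0 0 Oc)).submatrix embAC embAC =
      fromBlocks Oa 0 0 Oc := by
    ext (i | i) (j | j) <;> rfl
  have rAB := hR.sub embAB
  have rAC := hR.sub embAC
  rw [oAB] at rAB
  rw [oAC] at rAC
  have pAB := hγ.submatrix iAB
  have pAC := hγ.submatrix iAC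
  have b1 := E2_le (W := V.submatrix embAB embAB) ha hb pAB rAB (hle.submatrix embAB)
  have b2 := E2_le (W := V.submatrix embAC embAC) ha hc pAC rAC (hle.submatrix embAC)
  -- complementary determinants
  let e1 : (a ⊕ b) ⊕ c ≃ a ⊕ (b ⊕ c) := Equiv.sumAssoc a b c
  let e2 : (a ⊕ c) ⊕ b ≃ a ⊕ (b ⊕ c) :=
    (Equiv.sumAssoc a c b).trans (Equiv.sumCongr (Equiv.refl a) (Equiv.sumComm c b))
  have o1 : (fromBlocks Oa 0 0 (fromBlocks Ob 0 0 Oc)).submatrix e1 e1 =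
      fromBlocks (fromBlocks Oa 0 0 Ob) 0 0 Oc := by
    ext ((i | i) | i) ((j | j) | j) <;> rfl
  have o2 : (fromBlocks Oa 0 0 (fromBlocks Ob 0 0 Oc)).submatrix e2 e2 =
      fromBlocks (fromBlocks Oa 0 0 Oc) 0 0 Ob := by
    ext ((i | i) | i) ((j | j) | j) <;> rfl
  have hs : ∀ {k : Type _} [Fintype k] [DecidableEq k] (e : k ≃ a ⊕ (b ⊕ c)),
      γ.submatrix e e * (fromBlocks Oa 0 0 (fromBlocks Ob 0 0 Oc)).submatrix e e *
        (γ.submatrix e e)ᵀ = (fromBlocks Oa 0 0 (fromBlocks Ob 0 0 Oc)).submatrix e e := by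
    intro k _ _ e
    rw [transpose_submatrix, submatrix_mul_equiv, submatrix_mul_equiv, hγO]
  have s1 := hs e1
  have s2 := hs e2
  rw [o1] at s1
  rw [o2] at s2
  have d1 := pure_det (ha.blocks hb) hc (hγ.submatrix e1.injective) s1
  have d2 := pure_det (ha.blocks hc) hb (hγ.submatrix e2.injective) s2
  have f1 : (γ.submatrix e1 e1).toBlocks₁₁ = γ.submatrix embAB embAB := by
    ext (i | i) (j | j) <;> rfl
  have f2 : (γ.submatrix e2 e2).toBlocks₁₁ = γ.submatrix embAC embAC := by
    ext (i | i) (j | j) <;> rfl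
  have f3 : (γ.submatrix e1 e1).toBlocks₂₂ = (γ.submatrix embAC embAC).toBlocks₂₂ := rfl
  have f4 : (γ.submatrix e2 e2).toBlocks₂₂ = (γ.submatrix embAB embAB).toBlocks₂₂ := rfl
  have f5 : (γ.submatrix embAB embAB).toBlocks₁₁ = γ.toBlocks₁₁ := rfl
  have f6 : (γ.submatrix embAC embAC).toBlocks₁₁ = γ.toBlocks₁₁ := rfl
  rw [f1, f3] at d1
  rw [f2, f4] at d2
  rw [f5, d1] at b1
  rw [f6, d2] at b2
  have pA : 0 < γ.toBlocks₁₁.det := (hγ.submatrix Sum.inl_injective).det_pos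
  have pB : 0 < (γ.submatrix embAB embAB).toBlocks₂₂.det := by rw [← d2]; exact pAC.det_pos
  have pC : 0 < (γ.submatrix embAC embAC).toBlocks₂₂.det := by rw [← d1]; exact pAB.det_pos
  rw [Real.log_div (by positivity) (by positivity), Real.log_mul (by positivity) (by positivity)]
    at b1 b2
  linarith

end
end R2

/-- **Monogamy of the Gaussian Rényi-2 entanglement.** For every real symmetric positive
definite quantum covariance matrix `V` on `A ⊕ (B ⊕ C)`,
`E₂(A:BC)_V ≥ E₂(A:B)_{V_{AB}} + E₂(A:C)_{V_{AC}}`. -/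
theorem renyi2_entanglement_monogamy (nA nB nC : ℕ)
    (V : Matrix ((Fin nA × Fin 2) ⊕ ((Fin nB × Fin 2) ⊕ (Fin nC × Fin 2)))
        ((Fin nA × Fin 2) ⊕ ((Fin nB × Fin 2) ⊕ (Fin nC × Fin 2))) ℝ)
    (hVsymm : V.IsSymm) (hVpd : V.PosDef)
    (hQCM : QCM (fromBlocks (Omega nA) 0 0 (fromBlocks (Omega nB) 0 0 (Omega nC))) V) :
    E2 (fromBlocks (Omega nA) 0 0 (Omega nB))
        (V.submatrix (embAB (c := Fin nC × Fin 2)) (embAB (c := Fin nC × Fin 2)))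
      + E2 (fromBlocks (Omega nA) 0 0 (Omega nC))
        (V.submatrix (embAC (b := Fin nB × Fin 2)) (embAC (b := Fin nB × Fin 2)))
      ≤ E2 (fromBlocks (Omega nA) 0 0 (fromBlocks (Omega nB) 0 0 (Omega nC))) V := by
  have fA := R2.Omega_form nA
  have fBC := (R2.Omega_form nB).blocks (R2.Omega_form nC)
  have hO := fA.blocks fBC
  obtain ⟨G, hG, hGO, hGW, -⟩ := R2.pure_exists hO hVpd (R2.RQ_of_QCM hO.skew hVpd.1 hQCM)
  refine le_csInf ⟨_, G, R2.symm_of hG.1, hG, hGO, hGW, rfl⟩ ?_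
  rintro r ⟨γ, -, hγ, hγO, hle, rfl⟩
  exact R2.pure_bound fA (R2.Omega_form nB) (R2.Omega_form nC) hγ hγO hle

end
end
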